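/- Assume (S1) and (S2). Then for (f_i, f_j, f_k) ∈ ℝ³ one has Q^H ≤ 0 if and only if there exists an index q ∈ {i,j,k} such that A_q > 0 and κ_q ≥ (−B_q + √Δ_q)/(2A_q). (This gives the explicit description of the hyperbolic admissible space: the nondegenerate hyperbolic discrete conformal structures are exactly the complement in ℝ³ of the union of the regions V_q = {κ_q ≥ (−B_q + √Δ_q)/(2A_q)} over those q with A_q > 0.) -/

import Mathlib

/-- `C_q = √(1 + ε_q e^{2f_q})`. -/
noncomputable def CH (ε f : ℝ) : ℝ := Real.sqrt (1 + ε * Real.exp f ^ 2)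

/-- `κ_q = C_q / S_q`. -/
noncomputable def kH (ε f : ℝ) : ℝ := CH ε f / Real.exp f

/-- The quantity `Q^H` (with `κ_q = C_q/S_q`, including the symmetric term `G`). -/
noncomputable def QH (εi εj εk ηij ηik ηjk fi fj fk : ℝ) : ℝ :=
  (εj * εk - ηjk ^ 2) * kH εi fi ^ 2 + (εi * εk - ηik ^ 2) * kH εj fj ^ 2 +
    (εi * εj - ηij ^ 2) * kH εk fk ^ 2 +
    2 * (εk * ηij + ηik * ηjk) * kH εi fi * kH εj fj +
    2 * (εj * ηik + ηij * ηjk) * kH εi fi * kH εk fk +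
    2 * (εi * ηjk + ηij * ηik) * kH εj fj * kH εk fk +
    (εi * ηjk ^ 2 + εj * ηik ^ 2 + εk * ηij ^ 2 + 2 * ηij * ηik * ηjk - εi * εj * εk)

noncomputable def AHi (εi εj εk ηij ηik ηjk : ℝ) : ℝ := ηjk ^ 2 - εj * εk

noncomputable def BHi (εi εj εk ηij ηik ηjk fi fj fk : ℝ) : ℝ :=
  -2 * ((εk * ηij + ηik * ηjk) * kH εj fj + (εj * ηik + ηij * ηjk) * kH εk fk)

noncomputable def CHi (εi εj εk ηij ηik ηjk fi fj fk : ℝ) : ℝ :=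
  (ηik ^ 2 - εi * εk) * kH εj fj ^ 2 + (ηij ^ 2 - εi * εj) * kH εk fk ^ 2 -
    2 * (εi * ηjk + ηij * ηik) * kH εj fj * kH εk fk -
    (εi * ηjk ^ 2 + εj * ηik ^ 2 + εk * ηij ^ 2 + 2 * ηij * ηik * ηjk - εi * εj * εk)

/-- `Δ_i = B_i² − 4 A_i C_i`. -/
noncomputable def DeltaHi (εi εj εk ηij ηik ηjk fi fj fk : ℝ) : ℝ :=
  BHi εi εj εk ηij ηik ηjk fi fj fk ^ 2 -
    4 * AHi εi εj εk ηij ηik ηjk * CHi εi εj εk ηij ηik ηjk fi fj fk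

/-- Region `V_i`: `A_i > 0` and `κ_i ≥ (−B_i + √Δ_i)/(2A_i)`; `V_j`, `V_k` are obtained
by cyclically permuting the arguments. -/
noncomputable def VHi (εi εj εk ηij ηik ηjk fi fj fk : ℝ) : Prop :=
  0 < AHi εi εj εk ηij ηik ηjk ∧
    (-BHi εi εj εk ηij ηik ηjk fi fj fk +
        Real.sqrt (DeltaHi εi εj εk ηij ηik ηjk fi fj fk)) /
      (2 * AHi εi εj εk ηij ηik ηjk) ≤ kH εi fi

theorem kH_pos {ε : ℝ} (hε : ε = 0 ∨ ε = 1) (f : ℝ) : 0 < kH ε f := by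
  have : 0 ≤ ε := by rcases hε with rfl | rfl <;> norm_num
  unfold kH CH
  positivity

theorem one_le_kH_one (f : ℝ) : 1 ≤ kH 1 f := by
  unfold kH CH
  rw [one_le_div (Real.exp_pos f)]
  exact Real.le_sqrt_of_sq_le (by linarith)

/-- `Q^H`, viewed as a quadratic polynomial in `κ_i`. -/
theorem QH_eq_quadratic (εi εj εk ηij ηik ηjk fi fj fk : ℝ) :
    QH εi εj εk ηij ηik ηjk fi fj fk =
      -(AHi εi εj εk ηij ηik ηjk * kH εi fi ^ 2 +
        BHi εi εj εk ηij ηik ηjk fi fj fk * kH εi fi +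
        CHi εi εj εk ηij ηik ηjk fi fj fk) := by
  unfold QH AHi BHi CHi
  ring

theorem QH_cyclic (εi εj εk ηij ηik ηjk fi fj fk : ℝ) :
    QH εj εk εi ηjk ηij ηik fj fk fi = QH εi εj εk ηij ηik ηjk fi fj fk := by
  unfold QH
  ring

theorem QH_nonpos_of_VHi {εi εj εk ηij ηik ηjk fi fj fk : ℝ}
    (h : VHi εi εj εk ηij ηik ηjk fi fj fk) : QH εi εj εk ηij ηik ηjk fi fj fk ≤ 0 := by
  obtain ⟨hA, h⟩ := h
  rw [div_le_iff₀ (by linarith)] at h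
  have hs := (Real.sqrt_le_iff (x := DeltaHi εi εj εk ηij ηik ηjk fi fj fk)
    (y := kH εi fi * (2 * AHi εi εj εk ηij ηik ηjk) +
      BHi εi εj εk ηij ηik ηjk fi fj fk)).1 (by linarith)
  rw [QH_eq_quadratic, neg_nonpos]
  refine nonneg_of_mul_nonneg_right (a := 4 * AHi εi εj εk ηij ηik ηjk) ?_ (by linarith)
  have := hs.2
  unfold DeltaHi at this
  linarith

theorem VHi_of_QH_nonpos {εi εj εk ηij ηik ηjk fi fj fk : ℝ}
    (hQ : QH εi εj εk ηij ηik ηjk fi fj fk ≤ 0)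
    (hA : 0 < AHi εi εj εk ηij ηik ηjk)
    (h : 0 ≤ kH εi fi * (2 * AHi εi εj εk ηij ηik ηjk) +
      BHi εi εj εk ηij ηik ηjk fi fj fk) : VHi εi εj εk ηij ηik ηjk fi fj fk := by
  refine ⟨hA, ?_⟩
  rw [div_le_iff₀ (by linarith)]
  suffices Real.sqrt (DeltaHi εi εj εk ηij ηik ηjk fi fj fk) ≤
      kH εi fi * (2 * AHi εi εj εk ηij ηik ηjk) + BHi εi εj εk ηij ηik ηjk fi fj fk by
    linarith
  refine Real.sqrt_le_iff.2 ⟨h, ?_⟩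
  rw [QH_eq_quadratic, neg_nonpos] at hQ
  have := mul_nonneg (by linarith : 0 ≤ 4 * AHi εi εj εk ηij ηik ηjk) hQ
  unfold DeltaHi
  linarith

/-- If `Q^H ≤ 0` outside `V_i`, then the derivative `2A_iκ_i + B_i` of `-Q^H` with respect to
`κ_i` is nonpositive. -/
theorem two_mul_AHi_add_BHi_nonpos_of_not_VHi {εi εj εk ηij ηik ηjk fi fj fk : ℝ}
    (hεi : εi = 0 ∨ εi = 1) (hεj : εj = 0 ∨ εj = 1) (hεk : εk = 0 ∨ εk = 1)
    (hγj : 0 ≤ εj * ηik + ηij * ηjk) (hγk : 0 ≤ εk * ηij + ηik * ηjk)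
    (hQ : QH εi εj εk ηij ηik ηjk fi fj fk ≤ 0)
    (h : ¬ VHi εi εj εk ηij ηik ηjk fi fj fk) :
    kH εi fi * (2 * AHi εi εj εk ηij ηik ηjk) +
      BHi εi εj εk ηij ηik ηjk fi fj fk ≤ 0 := by
  by_cases hA : 0 < AHi εi εj εk ηij ηik ηjk
  · by_contra! h'
    exact h (VHi_of_QH_nonpos hQ hA h'.le)
  · have h₁ := mul_nonneg hγk (kH_pos hεj fj).le
    have h₂ := mul_nonneg hγj (kH_pos hεk fk).le
    have h₃ := mul_nonneg (kH_pos hεi fi).le (neg_nonneg.2 (not_lt.1 hA))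
    unfold BHi
    linarith

theorem sum_sq_add_two_mul_sub_one_pos {a b c : ℝ} (ha : 1 < a) (hb : -1 < b) (hc : -1 < c) :
    0 < a ^ 2 + b ^ 2 + c ^ 2 + 2 * a * b * c - 1 := by
  have ha' : 0 < a ^ 2 - 1 := by nlinarith
  rcases lt_or_ge b 0 with hb0 | hb0
  · have : 0 < (a ^ 2 - 1) * (1 - b ^ 2) := mul_pos ha' (by nlinarith)
    nlinarith [sq_nonneg (c + a * b)]
  rcases lt_or_ge c 0 with hc0 | hc0
  · have : 0 < (a ^ 2 - 1) * (1 - c ^ 2) := mul_pos ha' (by nlinarith)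
    nlinarith [sq_nonneg (b + a * c)]
  · have : 0 ≤ a * b * c := by positivity
    nlinarith [sq_nonneg b, sq_nonneg c]

theorem quadratic_pos_of_le_one {a b c x y z : ℝ}
    (ha : -1 < a) (hb : -1 < b) (hc : -1 < c) (ha' : a ≤ 1) (hb' : b ≤ 1) (hc' : c ≤ 1)
    (h₁ : 0 ≤ c + a * b) (h₂ : 0 ≤ b + a * c) (h₃ : 0 ≤ a + b * c)
    (hx : 1 ≤ x) (hy : 1 ≤ y) (hz : 1 ≤ z) :
    0 < (1 - c ^ 2) * x ^ 2 + (1 - b ^ 2) * y ^ 2 + (1 - a ^ 2) * z ^ 2 +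
      2 * (a + b * c) * x * y + 2 * (b + a * c) * x * z + 2 * (c + a * b) * y * z +
      (c ^ 2 + b ^ 2 + a ^ 2 + 2 * a * b * c - 1) := by
  have key : 0 < (1 + a) * (1 + b) * (1 + c) :=
    mul_pos (mul_pos (by linarith) (by linarith)) (by linarith)
  have e₁ : 0 ≤ (1 - c ^ 2) * (x ^ 2 - 1) := mul_nonneg (by nlinarith) (by nlinarith)
  have e₂ : 0 ≤ (1 - b ^ 2) * (y ^ 2 - 1) := mul_nonneg (by nlinarith) (by nlinarith)
  have e₃ : 0 ≤ (1 - a ^ 2) * (z ^ 2 - 1) := mul_nonneg (by nlinarith) (by nlinarith)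
  have e₄ : 0 ≤ (a + b * c) * (x * y - 1) := mul_nonneg h₃ (by nlinarith)
  have e₅ : 0 ≤ (b + a * c) * (x * z - 1) := mul_nonneg h₂ (by nlinarith)
  have e₆ : 0 ≤ (c + a * b) * (y * z - 1) := mul_nonneg h₁ (by nlinarith)
  linarith

/-- Under the structure conditions, the constant term of `Q^H` is positive unless all weights
`ε` are `1` and all `η` are at most `1`. -/
theorem constant_term_pos_or {εi εj εk ηij ηik ηjk : ℝ}
    (hεi : εi = 0 ∨ εi = 1) (hεj : εj = 0 ∨ εj = 1) (hεk : εk = 0 ∨ εk = 1)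
    (hS1ij : 0 < εi * εj + ηij) (hS1ik : 0 < εi * εk + ηik) (hS1jk : 0 < εj * εk + ηjk)
    (hS2i : 0 ≤ εi * ηjk + ηij * ηik) (hS2j : 0 ≤ εj * ηik + ηij * ηjk)
    (hS2k : 0 ≤ εk * ηij + ηik * ηjk) :
    0 < εi * ηjk ^ 2 + εj * ηik ^ 2 + εk * ηij ^ 2 + 2 * ηij * ηik * ηjk - εi * εj * εk ∨
      (εi = 1 ∧ εj = 1 ∧ εk = 1 ∧ ηij ≤ 1 ∧ ηik ≤ 1 ∧ ηjk ≤ 1) := by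
  rcases hεi with rfl | rfl <;> rcases hεj with rfl | rfl <;> rcases hεk with rfl | rfl <;>
    norm_num at hS1ij hS1ik hS1jk hS2i hS2j hS2k ⊢
  · positivity
  · positivity
  · positivity
  · nlinarith [sq_nonneg (ηij - ηik), mul_pos (mul_pos hS1ij hS1ik) hS1jk, mul_pos hS1ij hS1ik]
  · positivity
  · nlinarith [sq_nonneg (ηij - ηjk), mul_pos hS1ij hS1jk, mul_pos (mul_pos hS1ij hS1jk) hS1ik]
  · nlinarith [sq_nonneg (ηik - ηjk), mul_pos hS1ik hS1jk, mul_pos (mul_pos hS1ik hS1jk) hS1ij]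
  · rcases lt_or_ge 1 ηij with h | hij
    · left
      linarith [sum_sq_add_two_mul_sub_one_pos (a := ηij) (b := ηik) (c := ηjk) h
        (by linarith) (by linarith)]
    rcases lt_or_ge 1 ηik with h | hik
    · left
      linarith [sum_sq_add_two_mul_sub_one_pos (a := ηik) (b := ηij) (c := ηjk) h
        (by linarith) (by linarith)]
    rcases lt_or_ge 1 ηjk with h | hjk
    · left
      linarith [sum_sq_add_two_mul_sub_one_pos (a := ηjk) (b := ηij) (c := ηik) h
        (by linarith) (by linarith)]
    exact .inr ⟨hij, hik, hjk⟩

theorem stmt17 (εi εj εk ηij ηik ηjk : ℝ)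
    (hεi : εi = 0 ∨ εi = 1) (hεj : εj = 0 ∨ εj = 1) (hεk : εk = 0 ∨ εk = 1)
    (hS1ij : 0 < εi * εj + ηij) (hS1ik : 0 < εi * εk + ηik) (hS1jk : 0 < εj * εk + ηjk)
    (hS2i : 0 ≤ εi * ηjk + ηij * ηik) (hS2j : 0 ≤ εj * ηik + ηij * ηjk)
    (hS2k : 0 ≤ εk * ηij + ηik * ηjk)
    (fi fj fk : ℝ) :
    QH εi εj εk ηij ηik ηjk fi fj fk ≤ 0 ↔
      (VHi εi εj εk ηij ηik ηjk fi fj fk ∨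
        VHi εj εk εi ηjk ηij ηik fj fk fi ∨
        VHi εk εi εj ηik ηjk ηij fk fi fj) := by
  have hQj := QH_cyclic εi εj εk ηij ηik ηjk fi fj fk
  have hQk := (QH_cyclic εk εi εj ηik ηjk ηij fk fi fj).symm
  constructor
  · intro hQ
    by_contra! hV
    obtain ⟨hVi, hVj, hVk⟩ := hV
    rcases constant_term_pos_or hεi hεj hεk hS1ij hS1ik hS1jk hS2i hS2j hS2k with
      hG | ⟨rfl, rfl, rfl, hij, hik, hjk⟩
    · have hi := two_mul_AHi_add_BHi_nonpos_of_not_VHi hεi hεj hεk hS2j hS2k hQ hVi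
      have hj := two_mul_AHi_add_BHi_nonpos_of_not_VHi hεj hεk hεi (by linarith) (by linarith)
        (hQj.trans_le hQ) hVj
      have hk := two_mul_AHi_add_BHi_nonpos_of_not_VHi hεk hεi hεj (by linarith) (by linarith)
        (hQk.trans_le hQ) hVk
      have hi' := mul_nonneg (kH_pos hεi fi).le (neg_nonneg.2 hi)
      have hj' := mul_nonneg (kH_pos hεj fj).le (neg_nonneg.2 hj)
      have hk' := mul_nonneg (kH_pos hεk fk).le (neg_nonneg.2 hk)
      unfold QH at hQ
      unfold AHi BHi at hi' hj' hk'
      linarith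
    · have := quadratic_pos_of_le_one (a := ηij) (b := ηik) (c := ηjk)
        (by linarith) (by linarith) (by linarith) hij hik hjk
        (by linarith) (by linarith) (by linarith)
        (one_le_kH_one fi) (one_le_kH_one fj) (one_le_kH_one fk)
      unfold QH at hQ
      linarith
  · rintro (h | h | h)
    · exact QH_nonpos_of_VHi h
    · exact hQj.symm.trans_le (QH_nonpos_of_VHi h)
    · exact hQk.symm.trans_le (QH_nonpos_of_VHi h)
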